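/- Let Λ and Λ' be vertex lattices in C (i.e. O-submodules with π·Λ^♯ ⊆ Λ ⊆ Λ^♯ and π·Λ'^♯ ⊆ Λ' ⊆ Λ'^♯). Suppose there exists a vertex lattice Λ₂ with Λ₂ ⊆ Λ ∩ Λ'. Then Λ ∩ Λ' is a vertex lattice, i.e. π·(Λ ∩ Λ')^♯ ⊆ Λ ∩ Λ' ⊆ (Λ ∩ Λ')^♯. -/

import Mathlib

/-!
Statement 5: Let `Λ, Λ'` be vertex lattices in `C` (O-submodules with
`π·Λ^♯ ⊆ Λ ⊆ Λ^♯`).  If there exists a vertex lattice `Λ₂` with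
`Λ₂ ⊆ Λ ∩ Λ'`, then `Λ ∩ Λ'` is a vertex lattice.
-/

noncomputable section

variable (O : Type*) [CommRing O] {F : Type*} [Field F] [Algebra O F]
variable {C : Type*} [AddCommGroup C] [Module F C] [Module O C] [IsScalarTower O F C]
variable {σ : F →+* F}

/-- The dual `L^♯` of a subset `L ⊆ C` with respect to the `σ`-sesquilinear form `B`:
all `x` such that `B x y` lies in (the image of) `O` for every `y ∈ L`. -/
def sharpSet (B : C →ₗ[F] C →ₛₗ[σ] F) (L : Set C) : Set C :=
  {x : C | ∀ y ∈ L, B x y ∈ Set.range (algebraMap O F)}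

/-- `Λ` is a vertex lattice: `π · Λ^♯ ⊆ Λ` and `Λ ⊆ Λ^♯`. -/
def IsVertexLattice (B : C →ₗ[F] C →ₛₗ[σ] F) (π : O) (Λ : Submodule O C) : Prop :=
  (∀ x ∈ sharpSet O B (Λ : Set C), π • x ∈ Λ) ∧ (Λ : Set C) ⊆ sharpSet O B (Λ : Set C)

theorem inf_isVertexLattice (B : C →ₗ[F] C →ₛₗ[σ] F) (π : O)
    (hσinv : ∀ a : F, σ (σ a) = a)
    (hσO : ∀ a ∈ Set.range (algebraMap O F), σ a ∈ Set.range (algebraMap O F))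
    (Λ Λ' : Submodule O C)
    (hΛ : IsVertexLattice O B π Λ) (hΛ' : IsVertexLattice O B π Λ')
    (h₂ : ∃ Λ₂ : Submodule O C, IsVertexLattice O B π Λ₂ ∧ Λ₂ ≤ Λ ⊓ Λ') :
    IsVertexLattice O B π (Λ ⊓ Λ') := by
  obtain ⟨Λ₂, hΛ₂, hle⟩ := h₂
  exact ⟨fun x hx => hle (hΛ₂.1 x fun y hy => hx y (hle hy)),
    fun x hx y hy => hΛ.2 hx.1 y hy.1⟩
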